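/- Let k be an algebraically closed field of characteristic p = 2 and let R = k⟦x,y,z⟧/(z^2 + x^3 + y^2 z) (the rational double point of type E_6^0 in characteristic 2). With L and A as in the context: (i) the image of z/(xy) in L does not lie in A; (ii) (z/(xy))^2 lies in A; (iii) for every c ∈ L such that c^{2^m} ∈ A for some m ≥ 0, there exists a ∈ k such that c − a·(z/(xy)) ∈ A. In other words, H^2_m(R)[F^∞] is the one-dimensional k-vector space spanned by the class of z/(xy), annihilated by Frobenius. -/

import Mathlib

set_option maxHeartbeats 1000000
set_option synthInstance.maxHeartbeats 400000

open MvPowerSeries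

noncomputable section

variable (k : Type) [Field k]

/-- The formal power series ring `k⟦x,y,z⟧`. -/
abbrev PS := MvPowerSeries (Fin 3) k

/-- The hypersurface singularity `R = k⟦x,y,z⟧/(f)`. -/
abbrev Rq (f : PS k) : Type := PS k ⧸ Ideal.span {f}

/-- The image of `x` in `R`. -/
abbrev xR (f : PS k) : Rq k f := Ideal.Quotient.mk _ (X 0)
/-- The image of `y` in `R`. -/
abbrev yR (f : PS k) : Rq k f := Ideal.Quotient.mk _ (X 1)
/-- The image of `z` in `R`. -/
abbrev zR (f : PS k) : Rq k f := Ideal.Quotient.mk _ (X 2)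

/-- `L`: the localization of `R` inverting `x*y`. -/
abbrev Lloc (f : PS k) : Type := Localization.Away (xR k f * yR k f)

/-- The canonical map from the localization of `R` inverting `x` to `L`. -/
noncomputable def phiX (f : PS k) : Localization.Away (xR k f) →+* Lloc k f :=
  IsLocalization.Away.awayToAwayRight (S := Localization.Away (xR k f)) (P := Lloc k f)
    (xR k f) (yR k f)

/-- The canonical map from the localization of `R` inverting `y` to `L`. -/
noncomputable def phiY (f : PS k) : Localization.Away (yR k f) →+* Lloc k f :=
  IsLocalization.Away.awayToAwayLeft (S := Localization.Away (yR k f)) (P := Lloc k f)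
    (yR k f) (xR k f)

/-- `A ⊆ L`: the `R`-submodule generated by the images of `R_x` and `R_y` in `L`.
The quotient `L/A` is a Čech description of the local cohomology `H^2_m(R)`. -/
def Asub (f : PS k) : Submodule (Rq k f) (Lloc k f) :=
  Submodule.span (Rq k f) (Set.range (phiX k f) ∪ Set.range (phiY k f))

/-- The element `z/(x*y) ∈ L`. -/
noncomputable def zxy (f : PS k) : Lloc k f :=
  Localization.mk (zR k f) ⟨xR k f * yR k f, Submonoid.mem_powers _⟩

/-- The element `f_j := z/(x*y^j) = z*x^(j-1)/(x*y)^j ∈ L` (for `j ≥ 1`). -/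
noncomputable def fcls (f : PS k) (j : ℕ) : Lloc k f :=
  Localization.mk (zR k f * xR k f ^ (j - 1)) ⟨(xR k f * yR k f) ^ j, j, rfl⟩

/-- The defining equation of the rational double point of type E6p0 in characteristic 2. -/
abbrev fRDP : PS k := X 2 ^ 2 + X 0 ^ 3 + X 1 ^ 2 * X 2

section Coefficients

variable {k}

/-- The exponent of the monomial `x^i y^j z^l`. -/
def expo (i j l : ℕ) : Fin 3 →₀ ℕ := Finsupp.equivFunOnFinite.symm ![i, j, l]

/-- The coefficient of `x^i y^j z^l` in a power series. -/
def cf (g : PS k) (i j l : ℕ) : k := coeff (expo i j l) g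

/-- The power series with prescribed coefficients. -/
def ofCf (h : ℕ → ℕ → ℕ → k) : PS k := fun e => h (e 0) (e 1) (e 2)

@[simp] lemma expo_zero (i j l : ℕ) : expo i j l 0 = i := rfl

@[simp] lemma expo_one (i j l : ℕ) : expo i j l 1 = j := rfl

@[simp] lemma expo_two (i j l : ℕ) : expo i j l 2 = l := rfl

lemma expo_apply (e : Fin 3 →₀ ℕ) : expo (e 0) (e 1) (e 2) = e := by
  ext s
  fin_cases s <;> rfl

lemma cf_ext {g h : PS k} (H : ∀ i j l, cf g i j l = cf h i j l) : g = h := by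
  ext e
  have := H (e 0) (e 1) (e 2)
  rwa [cf, cf, expo_apply] at this

@[simp] lemma cf_ofCf (h : ℕ → ℕ → ℕ → k) (i j l : ℕ) : cf (ofCf h) i j l = h i j l := rfl

@[simp] lemma cf_add (g h : PS k) (i j l : ℕ) : cf (g + h) i j l = cf g i j l + cf h i j l :=
  map_add _ _ _

@[simp] lemma cf_sub (g h : PS k) (i j l : ℕ) : cf (g - h) i j l = cf g i j l - cf h i j l :=
  map_sub _ _ _

@[simp] lemma cf_C_mul (a : k) (g : PS k) (i j l : ℕ) : cf (C a * g) i j l = a * cf g i j l :=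
  coeff_C_mul _ _ _

lemma cf_X_pow_mul (s : Fin 3) (n : ℕ) (g : PS k) (i j l : ℕ) :
    cf (X s ^ n * g) i j l =
      if n ≤ expo i j l s then coeff (expo i j l - Finsupp.single s n) g else 0 := by
  rw [cf, X_pow_eq, coeff_monomial_mul, one_mul]
  simp only [Finsupp.single_le_iff]

@[simp] lemma cf_X_zero_pow_mul (n : ℕ) (g : PS k) (i j l : ℕ) :
    cf (X 0 ^ n * g) i j l = if n ≤ i then cf g (i - n) j l else 0 := by
  have h : expo i j l - Finsupp.single 0 n = expo (i - n) j l := by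
    ext s
    fin_cases s <;> simp
  rw [cf_X_pow_mul, expo_zero, h, cf]

@[simp] lemma cf_X_one_pow_mul (n : ℕ) (g : PS k) (i j l : ℕ) :
    cf (X 1 ^ n * g) i j l = if n ≤ j then cf g i (j - n) l else 0 := by
  have h : expo i j l - Finsupp.single 1 n = expo i (j - n) l := by
    ext s
    fin_cases s <;> simp
  rw [cf_X_pow_mul, expo_one, h, cf]

@[simp] lemma cf_X_two_pow_mul (n : ℕ) (g : PS k) (i j l : ℕ) :
    cf (X 2 ^ n * g) i j l = if n ≤ l then cf g i j (l - n) else 0 := by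
  have h : expo i j l - Finsupp.single 2 n = expo i j (l - n) := by
    ext s
    fin_cases s <;> simp
  rw [cf_X_pow_mul, expo_two, h, cf]

@[simp] lemma cf_X_two_mul (g : PS k) (i j l : ℕ) :
    cf (X 2 * g) i j l = if 1 ≤ l then cf g i j (l - 1) else 0 := by
  simpa using cf_X_two_pow_mul 1 g i j l

lemma cf_one (i j l : ℕ) : cf (1 : PS k) i j l = if i = 0 ∧ j = 0 ∧ l = 0 then 1 else 0 := by
  classical
  rw [cf, coeff_one]
  congr 1
  simp [DFunLike.ext_iff, Fin.forall_fin_succ]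

lemma cf_X_two (i j l : ℕ) : cf (X 2 : PS k) i j l = if i = 0 ∧ j = 0 ∧ l = 1 then 1 else 0 := by
  rw [← mul_one (X 2 : PS k), cf_X_two_mul, cf_one]
  split_ifs <;> first | rfl | omega

lemma cf_sq_two_mul [CharP k 2] (g : PS k) (i j l : ℕ) :
    cf (g ^ 2) (2 * i) (2 * j) (2 * l) = cf g i j l ^ 2 := by
  have h : expo (2 * i) (2 * j) (2 * l) = 2 • expo i j l := by
    ext s
    fin_cases s <;> rfl
  rw [← map_frobenius_expand 2 two_ne_zero, cf, h, coeff_map, coeff_expand_smul]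
  rfl

lemma cf_sq_of_odd [CharP k 2] (g : PS k) {i j l : ℕ} (s : Fin 3)
    (h : ¬ 2 ∣ expo i j l s) : cf (g ^ 2) i j l = 0 := by
  rw [← map_frobenius_expand 2 two_ne_zero, cf, coeff_map,
    coeff_expand_of_not_dvd 2 two_ne_zero g h, map_zero]

/-- A power series is reduced if it is of degree at most one in `z`. -/
def Reduced (g : PS k) : Prop := ∀ i j l, 2 ≤ l → cf g i j l = 0

/-- Coefficients of the quotient in the Weierstrass division of a power series by `fRDP`. -/
def quotCf (r : PS k) (i j l : ℕ) : k :=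
  cf r i j (l + 2) - (if 3 ≤ i then quotCf r (i - 3) j (l + 2) else 0)
    - (if 2 ≤ j then quotCf r i (j - 2) (l + 1) else 0)
termination_by i + j

lemma cf_fRDP_mul (w : PS k) (i j l : ℕ) :
    cf (fRDP k * w) i j l = (if 2 ≤ l then cf w i j (l - 2) else 0)
      + (if 3 ≤ i then cf w (i - 3) j l else 0)
      + (if 2 ≤ j then if 1 ≤ l then cf w i (j - 2) (l - 1) else 0 else 0) := by
  simp only [fRDP, add_mul, mul_assoc, cf_add, cf_X_two_pow_mul, cf_X_zero_pow_mul,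
    cf_X_one_pow_mul, cf_X_two_mul]

lemma exists_eq_fRDP_mul_add (r : PS k) : ∃ w g : PS k, Reduced g ∧ r = fRDP k * w + g := by
  refine ⟨ofCf (quotCf r), r - fRDP k * ofCf (quotCf r), ?_, by ring⟩
  intro i j l hl
  obtain ⟨l, rfl⟩ := Nat.exists_eq_add_of_le' hl
  rw [cf_sub, cf_fRDP_mul]
  simp only [cf_ofCf, Nat.add_sub_cancel, if_pos hl, if_pos (show 1 ≤ l + 2 by omega),
    show l + 2 - 1 = l + 1 by omega]
  rw [quotCf]
  ring

lemma cf_eq_zero_of_eq_fRDP_mul_add {g u v w : PS k} {N : ℕ} (hg : Reduced g)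
    (h : g = X 0 ^ N * u + X 1 ^ N * v + fRDP k * w) {i j : ℕ} (hi : i < N) (hj : j < N) (l : ℕ) :
    cf g i j l = 0 := by
  have key : ∀ i j l, i < N → j < N → cf g i j l = cf (fRDP k * w) i j l := by
    intro i j l hi hj
    rw [h]
    simp [hi.not_ge, hj.not_ge]
  have hw : ∀ n i j l, i + j = n → i < N → j < N → cf w i j l = 0 := by
    intro n
    induction n using Nat.strong_induction_on with
    | _ n ih =>
      intro i j l hn hi hj
      have h1 := key i j (l + 2) hi hj
      rw [hg _ _ _ (by omega), cf_fRDP_mul] at h1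
      have h2 : (if 3 ≤ i then cf w (i - 3) j (l + 2) else 0) = 0 := by
        split_ifs
        · exact ih (i - 3 + j) (by omega) _ _ _ rfl (by omega) hj
        · rfl
      have h3 : (if 2 ≤ j then if 1 ≤ l + 2 then cf w i (j - 2) (l + 2 - 1) else 0 else 0) = 0 := by
        split_ifs
        · exact ih (i + (j - 2)) (by omega) _ _ _ rfl hi (by omega)
        · rfl
        · rfl
      rw [h2, h3] at h1
      simpa using h1.symm
  rw [key i j l hi hj, cf_fRDP_mul]
  have h1 : cf w i j (l - 2) = 0 := hw _ _ _ _ rfl hi hj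
  have h2 : cf w (i - 3) j l = 0 := hw _ _ _ _ rfl (by omega) hj
  have h3 : cf w i (j - 2) (l - 1) = 0 := hw _ _ _ _ rfl hi (by omega)
  simp [h1, h2, h3]

lemma exists_eq_X_pow_mul_add {g : PS k} {N : ℕ}
    (h : ∀ i j l, i < N → j < N → cf g i j l = 0) :
    ∃ u v : PS k, g = X 0 ^ N * u + X 1 ^ N * v := by
  refine ⟨ofCf fun i j l => cf g (i + N) j l,
    ofCf fun i j l => if i < N then cf g i (j + N) l else 0, cf_ext fun i j l => ?_⟩
  simp only [cf_add, cf_X_zero_pow_mul, cf_X_one_pow_mul, cf_ofCf]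
  by_cases hi : N ≤ i
  · simp [hi, hi.not_gt]
  · by_cases hj : N ≤ j
    · simp [hi, hj, not_le.mp hi]
    · simp [hi, hj, h i j l (not_le.mp hi) (not_le.mp hj)]

lemma Reduced.exists_eq_add {g : PS k} (hg : Reduced g) :
    ∃ a b : PS k, g = a + X 2 * b ∧
      (∀ i j l, l ≠ 0 → cf a i j l = 0) ∧ (∀ i j l, l ≠ 0 → cf b i j l = 0) := by
  refine ⟨ofCf fun i j l => if l = 0 then cf g i j 0 else 0,
    ofCf fun i j l => if l = 0 then cf g i j 1 else 0, cf_ext fun i j l => ?_, ?_, ?_⟩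
  · simp only [cf_add, cf_X_two_mul, cf_ofCf]
    rcases l with _ | _ | l
    · simp
    · simp
    · simp [hg i j (l + 2) (by omega)]
  · intro i j l hl
    simp [hl]
  · intro i j l hl
    simp [hl]

end Coefficients

section LocalCohomology

variable {k}

lemma algebraMap_xR_mul_yR_isUnit (f : PS k) :
    IsUnit (algebraMap (Rq k f) (Lloc k f) (xR k f * yR k f)) :=
  IsLocalization.Away.algebraMap_isUnit _

lemma smul_eq_algebraMap_mul {f : PS k} (a : Rq k f) (c : Lloc k f) :
    a • c = algebraMap _ _ a * c :=
  Algebra.smul_def a c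

lemma mem_Asub_of_eq {f : PS k} {c : Lloc k f} {n : ℕ} {u v : Rq k f}
    (h : c * algebraMap _ _ (xR k f * yR k f) ^ n =
      algebraMap _ _ (xR k f ^ n * u + yR k f ^ n * v)) : c ∈ Asub k f := by
  have hx : phiX k f (IsLocalization.mk' _ v (⟨xR k f ^ n, n, rfl⟩ : Submonoid.powers (xR k f)))
      * algebraMap _ _ (xR k f ^ n) = algebraMap _ _ v := by
    rw [← IsLocalization.Away.awayToAwayRight_eq (S := Localization.Away (xR k f)) (xR k f)
      (yR k f) (xR k f ^ n), ← IsLocalization.Away.awayToAwayRight_eq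
      (S := Localization.Away (xR k f)) (xR k f) (yR k f) v, phiX, ← map_mul]
    congr 1
    exact IsLocalization.mk'_spec _ v (⟨xR k f ^ n, n, rfl⟩ : Submonoid.powers (xR k f))
  have hy : phiY k f (IsLocalization.mk' _ u (⟨yR k f ^ n, n, rfl⟩ : Submonoid.powers (yR k f)))
      * algebraMap _ _ (yR k f ^ n) = algebraMap _ _ u := by
    rw [← IsLocalization.Away.awayToAwayLeft_eq (S := Localization.Away (yR k f)) (yR k f)
      (xR k f) (yR k f ^ n), ← IsLocalization.Away.awayToAwayLeft_eq
      (S := Localization.Away (yR k f)) (yR k f) (xR k f) u, phiY, ← map_mul]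
    congr 1
    exact IsLocalization.mk'_spec _ u (⟨yR k f ^ n, n, rfl⟩ : Submonoid.powers (yR k f))
  have hc : c = phiX k f (IsLocalization.mk' _ v
        (⟨xR k f ^ n, n, rfl⟩ : Submonoid.powers (xR k f)))
      + phiY k f (IsLocalization.mk' _ u
        (⟨yR k f ^ n, n, rfl⟩ : Submonoid.powers (yR k f))) := by
    refine ((algebraMap_xR_mul_yR_isUnit f).pow n).mul_right_cancel ?_
    rw [h, add_mul, map_add, map_mul, map_mul, ← hx, ← hy]
    simp only [map_mul, map_pow, mul_pow]
    ring
  rw [hc]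
  exact add_mem (Submodule.subset_span (Or.inl ⟨_, rfl⟩)) (Submodule.subset_span (Or.inr ⟨_, rfl⟩))

lemma exists_eq_of_mem_Asub {f : PS k} {c : Lloc k f} (hc : c ∈ Asub k f) :
    ∃ (n : ℕ) (u v : Rq k f), c * algebraMap _ _ (xR k f * yR k f) ^ n =
      algebraMap _ _ (xR k f ^ n * u + yR k f ^ n * v) := by
  induction hc using Submodule.span_induction with
  | mem c hc =>
    rcases hc with ⟨s, rfl⟩ | ⟨s, rfl⟩
    · obtain ⟨n, a, h⟩ := IsLocalization.Away.surj (xR k f) s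
      refine ⟨n, 0, a, ?_⟩
      have h2 := congrArg (phiX k f) h
      rw [map_mul, map_pow, phiX, IsLocalization.Away.awayToAwayRight_eq,
        IsLocalization.Away.awayToAwayRight_eq] at h2
      rw [mul_zero, zero_add, map_mul _ (yR k f ^ n), ← h2, phiX]
      simp only [map_mul, map_pow, mul_pow]
      ring
    · obtain ⟨n, a, h⟩ := IsLocalization.Away.surj (yR k f) s
      refine ⟨n, a, 0, ?_⟩
      have h2 := congrArg (phiY k f) h
      rw [map_mul, map_pow, phiY, IsLocalization.Away.awayToAwayLeft_eq,
        IsLocalization.Away.awayToAwayLeft_eq] at h2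
      rw [mul_zero, add_zero, map_mul _ (xR k f ^ n), ← h2, phiY]
      simp only [map_mul, map_pow, mul_pow]
      ring
  | zero => exact ⟨0, 0, 0, by simp⟩
  | add c d _ _ hc hd =>
    obtain ⟨n, u, v, h⟩ := hc
    obtain ⟨m, u', v', h'⟩ := hd
    refine ⟨n + m, yR k f ^ m * u + yR k f ^ n * u', xR k f ^ m * v + xR k f ^ n * v', ?_⟩
    simp only [map_mul, map_pow, mul_pow, map_add, pow_add] at h h' ⊢
    linear_combination (algebraMap (Rq k f) (Lloc k f) (xR k f) ^ m *
        algebraMap (Rq k f) (Lloc k f) (yR k f) ^ m) * h +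
      (algebraMap (Rq k f) (Lloc k f) (xR k f) ^ n *
        algebraMap (Rq k f) (Lloc k f) (yR k f) ^ n) * h'
  | smul a c _ hc =>
    obtain ⟨n, u, v, h⟩ := hc
    refine ⟨n, a * u, a * v, ?_⟩
    rw [smul_eq_algebraMap_mul, mul_assoc, h, ← map_mul]
    congr 1
    ring

lemma mk_fRDP : (Ideal.Quotient.mk (Ideal.span {fRDP k}) (fRDP k) : Rq k (fRDP k)) = 0 :=
  Ideal.Quotient.eq_zero_iff_mem.mpr (Ideal.mem_span_singleton_self _)

lemma mem_Asub_iff {c : Lloc k (fRDP k)} {n : ℕ} {g : PS k} (hg : Reduced g)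
    (h : c * algebraMap _ _ (xR k (fRDP k) * yR k (fRDP k)) ^ n =
      algebraMap (Rq k (fRDP k)) _ (Ideal.Quotient.mk _ g)) :
    c ∈ Asub k (fRDP k) ↔ ∀ i j l, i < n → j < n → cf g i j l = 0 := by
  constructor
  · intro hc i j l hi hj
    obtain ⟨N, u, v, hN⟩ := exists_eq_of_mem_Asub hc
    have h1 : algebraMap (Rq k (fRDP k)) (Lloc k (fRDP k))
        ((xR k (fRDP k) * yR k (fRDP k)) ^ N * Ideal.Quotient.mk _ g) =
        algebraMap _ _ ((xR k (fRDP k) * yR k (fRDP k)) ^ n *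
          (xR k (fRDP k) ^ N * u + yR k (fRDP k) ^ N * v)) := by
      rw [map_mul, map_mul _ (_ ^ n), ← h, ← hN, map_pow, map_pow]
      ring
    obtain ⟨t, ht⟩ := IsLocalization.Away.exists_of_eq (xR k (fRDP k) * yR k (fRDP k)) h1
    obtain ⟨u, rfl⟩ := Ideal.Quotient.mk_surjective u
    obtain ⟨v, rfl⟩ := Ideal.Quotient.mk_surjective v
    simp only [← map_mul, ← map_pow, ← map_add] at ht
    rw [Ideal.Quotient.eq, Ideal.mem_span_singleton] at ht
    obtain ⟨w, hw⟩ := ht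
    have hred : Reduced (X 0 ^ (t + N) * (X 1 ^ (t + N) * g)) := by
      intro i j l hl
      simp [hg _ _ l hl]
    have h2 : X 0 ^ (t + N) * (X 1 ^ (t + N) * g) =
        X 0 ^ (t + n + N) * (X 1 ^ (t + n) * u) + X 1 ^ (t + n + N) * (X 0 ^ (t + n) * v)
          + fRDP k * w := by
      rw [← hw]
      ring
    have h3 := cf_eq_zero_of_eq_fRDP_mul_add hred h2 (i := i + (t + N)) (j := j + (t + N))
      (by omega) (by omega) l
    simpa using h3
  · intro H
    obtain ⟨u, v, rfl⟩ := exists_eq_X_pow_mul_add H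
    refine mem_Asub_of_eq (n := n) (u := Ideal.Quotient.mk _ u) (v := Ideal.Quotient.mk _ v) ?_
    rw [h]
    simp only [map_add, map_mul, map_pow]

lemma zxy_mul (f : PS k) :
    zxy k f * algebraMap _ _ (xR k f * yR k f) = algebraMap _ _ (zR k f) := by
  rw [zxy, Localization.mk_eq_mk']
  exact IsLocalization.mk'_spec _ (zR k f)
    (⟨xR k f * yR k f, Submonoid.mem_powers _⟩ : Submonoid.powers (xR k f * yR k f))

lemma zxy_notMem_Asub : zxy k (fRDP k) ∉ Asub k (fRDP k) := by
  have hred : Reduced (X 2 : PS k) := by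
    intro i j l hl
    rw [cf_X_two, if_neg (by omega)]
  intro hc
  have h := (mem_Asub_iff (n := 1) hred (by rw [pow_one, zxy_mul])).mp hc 0 0 1 one_pos one_pos
  simp [cf_X_two] at h

lemma zxy_sq_mem_Asub : zxy k (fRDP k) ^ 2 ∈ Asub k (fRDP k) := by
  refine mem_Asub_of_eq (n := 2) (u := - xR k (fRDP k)) (v := - zR k (fRDP k)) ?_
  rw [← mul_pow, zxy_mul, ← map_pow]
  congr 1
  have h := mk_fRDP (k := k)
  simp only [fRDP, map_add, map_mul, map_pow] at h
  linear_combination h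

lemma exists_reduced_eq (c : Lloc k (fRDP k)) : ∃ (n : ℕ) (g : PS k), Reduced g ∧
    c * algebraMap _ _ (xR k (fRDP k) * yR k (fRDP k)) ^ (n + 1) =
      algebraMap (Rq k (fRDP k)) _ (Ideal.Quotient.mk _ g) := by
  obtain ⟨n, r, h⟩ := IsLocalization.Away.surj (xR k (fRDP k) * yR k (fRDP k)) c
  obtain ⟨r, rfl⟩ := Ideal.Quotient.mk_surjective r
  obtain ⟨w, g, hg, hr⟩ := exists_eq_fRDP_mul_add (X 0 * X 1 * r)
  refine ⟨n, g, hg, ?_⟩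
  have h2 := congrArg (Ideal.Quotient.mk (Ideal.span {fRDP k})) hr
  rw [map_add, map_mul _ (fRDP k), mk_fRDP, zero_mul, zero_add] at h2
  rw [← h2, pow_succ, ← mul_assoc, h, ← map_mul, map_mul (Ideal.Quotient.mk _),
    map_mul (Ideal.Quotient.mk _)]
  congr 1
  ring

/-- If the square of a class is a multiple of the class of `z/(xy)`, then the class itself is. -/
lemma exists_sub_smul_zxy_mem_Asub_of_sq [CharP k 2] {c : Lloc k (fRDP k)} {α : k}
    (h : c ^ 2 - algebraMap k (Rq k (fRDP k)) α • zxy k (fRDP k) ∈ Asub k (fRDP k)) :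
    ∃ a : k, c - algebraMap k (Rq k (fRDP k)) a • zxy k (fRDP k) ∈ Asub k (fRDP k) := by
  obtain ⟨n, g, hg, hc⟩ := exists_reduced_eq c
  obtain ⟨a, b, rfl, ha, hb⟩ := hg.exists_eq_add
  have hC : ∀ β : k, algebraMap k (Rq k (fRDP k)) β = Ideal.Quotient.mk _ (C β) := fun _ => rfl
  have hz := zxy_mul (fRDP k)
  have hf := mk_fRDP (k := k)
  have h2 : (2 : Rq k (fRDP k)) = 0 := by
    have := congrArg (algebraMap k (Rq k (fRDP k))) (CharTwo.two_eq_zero (R := k))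
    rwa [map_zero, map_ofNat] at this
  have hnum : ∀ (β : k) (N : ℕ), algebraMap k (Rq k (fRDP k)) β • zxy k (fRDP k)
      * algebraMap _ _ (xR k (fRDP k) * yR k (fRDP k)) ^ (N + 1) =
      algebraMap (Rq k (fRDP k)) _
        (Ideal.Quotient.mk _ (C β * (X 0 ^ N * (X 1 ^ N * X 2)))) := by
    intro β N
    rw [smul_eq_algebraMap_mul, hC, pow_succ]
    simp only [map_mul, map_pow, mul_pow] at hz ⊢
    linear_combination (algebraMap (Rq k (fRDP k)) (Lloc k (fRDP k)) (Ideal.Quotient.mk _ (C β)) *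
      algebraMap (Rq k (fRDP k)) (Lloc k (fRDP k)) (xR k (fRDP k)) ^ N *
      algebraMap (Rq k (fRDP k)) (Lloc k (fRDP k)) (yR k (fRDP k)) ^ N) * hz
  have hsq : (c ^ 2 - algebraMap k (Rq k (fRDP k)) α • zxy k (fRDP k))
      * algebraMap _ _ (xR k (fRDP k) * yR k (fRDP k)) ^ (2 * n + 1 + 1) =
      algebraMap (Rq k (fRDP k)) _ (Ideal.Quotient.mk _ (a ^ 2 + X 0 ^ 3 * b ^ 2
        + X 1 ^ 2 * (X 2 * b ^ 2)
        - C α * (X 0 ^ (2 * n + 1) * (X 1 ^ (2 * n + 1) * X 2)))) := by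
    rw [sub_mul, hnum, show 2 * n + 1 + 1 = (n + 1) * 2 by ring, pow_mul, ← mul_pow, hc,
      map_sub, map_sub, ← map_pow]
    congr 2
    simp only [fRDP, map_add, map_mul, map_pow] at hf ⊢
    linear_combination (Ideal.Quotient.mk _ b) ^ 2 * hf +
      (Ideal.Quotient.mk _ a * Ideal.Quotient.mk _ b * zR k (fRDP k)
        - (Ideal.Quotient.mk _ b) ^ 2 * (xR k (fRDP k) ^ 3
          + yR k (fRDP k) ^ 2 * zR k (fRDP k))) * h2
  have hsq0 : ∀ {d : PS k}, (∀ i j l, l ≠ 0 → cf d i j l = 0) →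
      ∀ i j l, l ≠ 0 → cf (d ^ 2) i j l = 0 := by
    intro d hd i j l hl
    by_cases hp : (2 ∣ i ∧ 2 ∣ j) ∧ 2 ∣ l
    · obtain ⟨⟨⟨i, rfl⟩, ⟨j, rfl⟩⟩, ⟨l, rfl⟩⟩ := hp
      rw [cf_sq_two_mul, hd _ _ _ (by omega), zero_pow two_ne_zero]
    · rw [not_and_or, not_and_or] at hp
      rcases hp with (hp | hp) | hp
      · exact cf_sq_of_odd d 0 hp
      · exact cf_sq_of_odd d 1 hp
      · exact cf_sq_of_odd d 2 hp
  have hred : Reduced (a ^ 2 + X 0 ^ 3 * b ^ 2 + X 1 ^ 2 * (X 2 * b ^ 2)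
        - C α * (X 0 ^ (2 * n + 1) * (X 1 ^ (2 * n + 1) * X 2))) := by
    intro i j l hl
    simp [hsq0 ha _ _ l (by omega), hsq0 hb _ _ l (by omega), hsq0 hb _ _ (l - 1) (by omega),
      cf_X_two, show ¬ l = 1 by omega]
  have hzero := (mem_Asub_iff hred hsq).mp h
  have ha0 : ∀ i j, i < n + 1 → j < n + 1 → cf a i j 0 = 0 := by
    intro i j hi hj
    have h1 := hzero (2 * i) (2 * j) (2 * 0) (by omega) (by omega)
    simp only [cf_sub, cf_add, cf_X_zero_pow_mul, cf_X_one_pow_mul, cf_X_two_mul, cf_X_two, cf_C_mul,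
      cf_sq_two_mul] at h1
    have h3 : (if 3 ≤ 2 * i then cf (b ^ 2) (2 * i - 3) (2 * j) (2 * 0) else 0) = 0 := by
      split_ifs with h3
      · exact cf_sq_of_odd b 0 (by rw [expo_zero]; omega)
      · rfl
    rw [h3] at h1
    simpa using h1
  have hb0 : ∀ i j, i < n + 1 → j < n + 1 → ¬ (i = n ∧ j = n) → cf b i j 0 = 0 := by
    intro i j hi hj hij
    by_cases hin : i < n
    · have h1 := hzero (2 * i + 3) (2 * j) (2 * 0) (by omega) (by omega)
      simp only [cf_sub, cf_add, cf_X_zero_pow_mul, cf_X_one_pow_mul, cf_X_two_mul, cf_X_two, cf_C_mul,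
        Nat.add_sub_cancel, cf_sq_two_mul] at h1
      rw [cf_sq_of_odd a 0 (by rw [expo_zero]; omega)] at h1
      simpa using h1
    · have h1 := hzero (2 * i) (2 * j + 2) 1 (by omega) (by omega)
      simp only [cf_sub, cf_add, cf_X_zero_pow_mul, cf_X_one_pow_mul, cf_X_two_mul, cf_X_two, cf_C_mul,
        Nat.add_sub_cancel] at h1
      rw [show (1 - 1) = 2 * 0 by omega, cf_sq_two_mul, hsq0 ha _ _ 1 one_ne_zero,
        hsq0 hb _ _ 1 one_ne_zero] at h1
      rw [if_neg (show ¬ 2 * n + 1 ≤ 2 * i by omega)] at h1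
      simpa using h1
  refine ⟨cf b n n 0, ?_⟩
  have hlin : (c - algebraMap k (Rq k (fRDP k)) (cf b n n 0) • zxy k (fRDP k))
      * algebraMap _ _ (xR k (fRDP k) * yR k (fRDP k)) ^ (n + 1) =
      algebraMap (Rq k (fRDP k)) _ (Ideal.Quotient.mk _ (a + X 2 * b
        - C (cf b n n 0) * (X 0 ^ n * (X 1 ^ n * X 2)))) := by
    rw [sub_mul, hnum, hc, map_sub, map_sub]
  have hred' : Reduced (a + X 2 * b - C (cf b n n 0) * (X 0 ^ n * (X 1 ^ n * X 2))) := by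
    intro i j l hl
    simp [ha _ _ l (by omega), hb _ _ (l - 1) (by omega), cf_X_two, show ¬ l = 1 by omega]
  refine (mem_Asub_iff hred' hlin).mpr fun i j l hi hj => ?_
  rcases l with _ | l
  · simp [ha0 i j hi hj, cf_X_two]
  · simp only [cf_sub, cf_add, cf_X_zero_pow_mul, cf_X_one_pow_mul, cf_X_two_mul, cf_X_two, cf_C_mul,
      Nat.add_sub_cancel, ha i j (l + 1) (by omega)]
    rcases l with _ | l
    · by_cases hij : i = n ∧ j = n
      · obtain ⟨rfl, rfl⟩ := hij
        simp
      · rw [hb0 i j hi hj hij]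
        have : ¬ ((n ≤ i ∧ n ≤ j)) := by omega
        by_cases h1 : n ≤ i
        · simp [show ¬ n ≤ j by omega]
        · simp [h1]
    · simp [hb i j (l + 1) (by omega)]

end LocalCohomology

/-- For the rational double point `R` of type E6p0 in characteristic 2,
the Frobenius-nilpotent part `H^2_m(R)[F^∞]` of local cohomology `L/A` is the one-dimensional
`k`-vector space spanned by the class of `z/(xy)`, and it is annihilated by Frobenius. -/
theorem localCohomology_E6p0 (k : Type) [Field k] [IsAlgClosed k] [CharP k 2] :
    -- (i) the image of z/(xy) in L does not lie in A
    zxy k (fRDP k) ∉ Asub k (fRDP k) ∧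
    -- (ii) (z/(xy))^2 lies in A
    (zxy k (fRDP k)) ^ 2 ∈ Asub k (fRDP k) ∧
    -- (iii) every Frobenius-nilpotent class is a k-multiple of the class of z/(xy)
    (∀ c : Lloc k (fRDP k), (∃ m : ℕ, c ^ 2 ^ m ∈ Asub k (fRDP k)) →
      ∃ a : k, c - algebraMap k (Rq k (fRDP k)) a • zxy k (fRDP k) ∈ Asub k (fRDP k)) := by
  refine ⟨zxy_notMem_Asub, zxy_sq_mem_Asub, ?_⟩
  rintro c ⟨m, hm⟩
  induction m generalizing c with
  | zero => exact ⟨0, by rwa [map_zero, smul_eq_algebraMap_mul, map_zero, zero_mul, sub_zero,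
      ← pow_one c, ← pow_zero 2]⟩
  | succ m ih =>
    rw [pow_succ', pow_mul] at hm
    obtain ⟨α, hα⟩ := ih (c ^ 2) hm
    exact exists_sub_smul_zxy_mem_Asub_of_sq hα
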